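/- Let Y1, Y0, X be compact metric spaces with their Borel σ-algebras, let μ1X and μ0X be Borel probability measures on Y1 × X and Y0 × X respectively having the same X-marginal, and let m : Y1 × Y0 × X → ℝ^k be continuous. Then for every θ-specific moment function m the following are equivalent: (a) there exists μ ∈ M(μ1X, μ0X) with ∫ m dμ = 0 (the zero vector of ℝ^k); (b) for every t in the unit sphere of ℝ^k, the infimum over μ ∈ M(μ1X, μ0X) of ∫ ⟨t, m(y1, y0, x)⟩ dμ is at most 0. (This is the identity Θ_I = Θ_o of Theorem 1, in its equivalent unconditional optimal-transport formulation.) -/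

import Mathlib

open MeasureTheory
open scoped RealInnerProductSpace

/-- The set `M(μ1X, μ0X)` of probability measures on `Y1 × Y0 × X` whose projection on
`(Y1, X)` is `μ1X` and whose projection on `(Y0, X)` is `μ0X`. -/
def MSet {Y1 Y0 X : Type*} [MeasurableSpace Y1] [MeasurableSpace Y0] [MeasurableSpace X]
    (μ1X : Measure (Y1 × X)) (μ0X : Measure (Y0 × X)) :
    Set (Measure (Y1 × Y0 × X)) :=
  {μ | IsProbabilityMeasure μ ∧
    μ.map (fun p => (p.1, p.2.2)) = μ1X ∧ μ.map (fun p => (p.2.1, p.2.2)) = μ0X}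

section Helpers
open ProbabilityTheory Set

lemma MSet_nonempty {Y1 Y0 X : Type*}
    [MeasurableSpace Y1] [StandardBorelSpace Y1]
    [MeasurableSpace Y0] [StandardBorelSpace Y0] [MeasurableSpace X]
    (μ1X : Measure (Y1 × X)) (μ0X : Measure (Y0 × X))
    [IsProbabilityMeasure μ1X] [IsProbabilityMeasure μ0X]
    (hmarg : μ1X.map Prod.snd = μ0X.map Prod.snd) : (MSet μ1X μ0X).Nonempty := by
  have : Nonempty (Y1 × X) := nonempty_of_isProbabilityMeasure μ1X
  have : Nonempty (Y0 × X) := nonempty_of_isProbabilityMeasure μ0X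
  have : Nonempty Y1 := (inferInstance : Nonempty (Y1 × X)).map Prod.fst
  have : Nonempty Y0 := (inferInstance : Nonempty (Y0 × X)).map Prod.fst
  let ρ1 : Measure (X × Y1) := μ1X.map Prod.swap
  let ρ0 : Measure (X × Y0) := μ0X.map Prod.swap
  have i1 : IsProbabilityMeasure ρ1 := Measure.isProbabilityMeasure_map (by fun_prop)
  have i0 : IsProbabilityMeasure ρ0 := Measure.isProbabilityMeasure_map (by fun_prop)
  have h1 : ρ1.fst = μ1X.map Prod.snd := by
    simp only [ρ1, Measure.fst]
    rw [Measure.map_map (by fun_prop) (by fun_prop)]; rfl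
  have h0 : ρ0.fst = μ1X.map Prod.snd := by
    rw [hmarg]
    simp only [ρ0, Measure.fst]
    rw [Measure.map_map (by fun_prop) (by fun_prop)]; rfl
  let ν := μ1X.map Prod.snd
  have iν : IsProbabilityMeasure ν := Measure.isProbabilityMeasure_map (by fun_prop)
  have d1 : ν ⊗ₘ ρ1.condKernel = ρ1 := by
    have := ρ1.disintegrate ρ1.condKernel
    rwa [h1] at this
  have d0 : ν ⊗ₘ ρ0.condKernel = ρ0 := by
    have := ρ0.disintegrate ρ0.condKernel
    rwa [h0] at this
  let η : Measure (X × (Y1 × Y0)) := ν ⊗ₘ (ρ1.condKernel ×ₖ ρ0.condKernel)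
  have e1 : η.map (Prod.map id Prod.fst) = ρ1 := by
    rw [← Measure.compProd_map (by fun_prop), ← Kernel.fst_eq, Kernel.fst_prod, d1]
  have e0 : η.map (Prod.map id Prod.snd) = ρ0 := by
    rw [← Measure.compProd_map (by fun_prop), ← Kernel.snd_eq, Kernel.snd_prod, d0]
  refine ⟨η.map (fun q => (q.2.1, q.2.2, q.1)),
    Measure.isProbabilityMeasure_map (by fun_prop), ?_, ?_⟩
  · rw [Measure.map_map (by fun_prop) (by fun_prop)]
    have : μ1X = ρ1.map Prod.swap := by
      simp only [ρ1]
      rw [Measure.map_map (by fun_prop) (by fun_prop)]; simp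
    rw [this, ← e1, Measure.map_map (by fun_prop) (by fun_prop)]; rfl
  · rw [Measure.map_map (by fun_prop) (by fun_prop)]
    have : μ0X = ρ0.map Prod.swap := by
      simp only [ρ0]
      rw [Measure.map_map (by fun_prop) (by fun_prop)]; simp
    rw [this, ← e0, Measure.map_map (by fun_prop) (by fun_prop)]; rfl

lemma MSet_integral_compact {Y1 Y0 X : Type*}
    [MetricSpace Y1] [CompactSpace Y1] [MeasurableSpace Y1] [BorelSpace Y1]
    [MetricSpace Y0] [CompactSpace Y0] [MeasurableSpace Y0] [BorelSpace Y0]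
    [MetricSpace X] [CompactSpace X] [MeasurableSpace X] [BorelSpace X]
    (μ1X : Measure (Y1 × X)) (μ0X : Measure (Y0 × X))
    [IsProbabilityMeasure μ1X] [IsProbabilityMeasure μ0X]
    {k : ℕ} (m : Y1 × Y0 × X → EuclideanSpace ℝ (Fin k)) (hm : Continuous m) :
    IsCompact ((fun μ : Measure (Y1 × Y0 × X) => ∫ p, m p ∂μ) '' MSet μ1X μ0X) := by
  have hf1 : Continuous (fun p : Y1 × Y0 × X => (p.1, p.2.2)) := by fun_prop
  have hf0 : Continuous (fun p : Y1 × Y0 × X => (p.2.1, p.2.2)) := by fun_prop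
  let S : Set (ProbabilityMeasure (Y1 × Y0 × X)) :=
    {μ | μ.map (hf1.measurable.aemeasurable) = (⟨μ1X, inferInstance⟩ : ProbabilityMeasure _)} ∩
    {μ | μ.map (hf0.measurable.aemeasurable) = (⟨μ0X, inferInstance⟩ : ProbabilityMeasure _)}
  have hS : IsClosed S :=
    (isClosed_eq (ProbabilityMeasure.continuous_map hf1) continuous_const).inter
    (isClosed_eq (ProbabilityMeasure.continuous_map hf0) continuous_const)
  have hc : Continuous (fun μ : ProbabilityMeasure (Y1 × Y0 × X) => ∫ p, m p ∂(μ : Measure _)) := by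
    rw [← (EuclideanSpace.equiv (Fin k) ℝ).toHomeomorph.comp_continuous_iff]
    refine continuous_pi fun i => ?_
    have hmi : Continuous (fun p => m p i) := by fun_prop
    have := ProbabilityMeasure.continuous_integral_continuousMap (⟨_, hmi⟩ : C(Y1 × Y0 × X, ℝ))
    refine this.congr fun μ => ?_
    have hmInt : Integrable m (μ : Measure _) :=
      hm.integrable_of_hasCompactSupport (HasCompactSupport.of_compactSpace m)
    exact ContinuousLinearMap.integral_comp_comm (EuclideanSpace.proj i : _ →L[ℝ] ℝ) hmInt
  convert hS.isCompact.image hc using 1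
  ext v
  constructor
  · rintro ⟨μ, ⟨h, h1, h0⟩, rfl⟩
    exact ⟨⟨μ, h⟩, ⟨Subtype.ext h1, Subtype.ext h0⟩, rfl⟩
  · rintro ⟨μ, ⟨h1, h0⟩, rfl⟩
    exact ⟨μ, ⟨μ.2, congrArg Subtype.val h1, congrArg Subtype.val h0⟩, rfl⟩

lemma MSet_integral_convex {Y1 Y0 X : Type*}
    [MetricSpace Y1] [CompactSpace Y1] [MeasurableSpace Y1] [BorelSpace Y1]
    [MetricSpace Y0] [CompactSpace Y0] [MeasurableSpace Y0] [BorelSpace Y0]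
    [MetricSpace X] [CompactSpace X] [MeasurableSpace X] [BorelSpace X]
    (μ1X : Measure (Y1 × X)) (μ0X : Measure (Y0 × X))
    {k : ℕ} (m : Y1 × Y0 × X → EuclideanSpace ℝ (Fin k)) (hm : Continuous m) :
    Convex ℝ ((fun μ : Measure (Y1 × Y0 × X) => ∫ p, m p ∂μ) '' MSet μ1X μ0X) := by
  rintro _ ⟨μ, ⟨h, h1, h0⟩, rfl⟩ _ ⟨μ', ⟨h', h1', h0'⟩, rfl⟩ a b ha hb hab
  have hmInt : ∀ ν : Measure (Y1 × Y0 × X), IsProbabilityMeasure ν → Integrable m ν := fun ν _ =>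
      hm.integrable_of_hasCompactSupport (HasCompactSupport.of_compactSpace m)
  have hab' : ENNReal.ofReal a + ENNReal.ofReal b = 1 := by
    rw [← ENNReal.ofReal_add ha hb, hab, ENNReal.ofReal_one]
  refine ⟨ENNReal.ofReal a • μ + ENNReal.ofReal b • μ', ⟨⟨?_⟩, ?_, ?_⟩, ?_⟩
  · simp [hab']
  · rw [Measure.map_add _ _ (by fun_prop), Measure.map_smul, Measure.map_smul, h1, h1',
      ← add_smul, hab', one_smul]
  · rw [Measure.map_add _ _ (by fun_prop), Measure.map_smul, Measure.map_smul, h0, h0',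
      ← add_smul, hab', one_smul]
  · dsimp only
    rw [integral_add_measure ((hmInt μ h).smul_measure ENNReal.ofReal_ne_top)
      ((hmInt μ' h').smul_measure ENNReal.ofReal_ne_top), integral_smul_measure,
      integral_smul_measure, ENNReal.toReal_ofReal ha, ENNReal.toReal_ofReal hb]

end Helpers

/-- Theorem 1 (`Θ_I = Θ_o`), unconditional optimal-transport formulation. -/
theorem moment_zero_iff_sphere_OT_nonpos
    {Y1 Y0 X : Type*}
    [MetricSpace Y1] [CompactSpace Y1] [MeasurableSpace Y1] [BorelSpace Y1]
    [MetricSpace Y0] [CompactSpace Y0] [MeasurableSpace Y0] [BorelSpace Y0]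
    [MetricSpace X] [CompactSpace X] [MeasurableSpace X] [BorelSpace X]
    (μ1X : Measure (Y1 × X)) (μ0X : Measure (Y0 × X))
    [IsProbabilityMeasure μ1X] [IsProbabilityMeasure μ0X]
    (hmarg : μ1X.map Prod.snd = μ0X.map Prod.snd)
    {k : ℕ} (m : Y1 × Y0 × X → EuclideanSpace ℝ (Fin k)) (hm : Continuous m) :
    (∃ μ ∈ MSet μ1X μ0X, ∫ p, m p ∂μ = 0) ↔
      ∀ t : EuclideanSpace ℝ (Fin k), ‖t‖ = 1 →
        sInf {r : ℝ | ∃ μ ∈ MSet μ1X μ0X, r = ∫ p, ⟪t, m p⟫ ∂μ} ≤ 0 := by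
  

  have hmInt : ∀ ν ∈ MSet μ1X μ0X, Integrable m ν := fun ν hν =>
    have := hν.1
    hm.integrable_of_hasCompactSupport (HasCompactSupport.of_compactSpace m)
  have hK := MSet_integral_compact μ1X μ0X m hm
  have hC := MSet_integral_convex μ1X μ0X m hm
  have hN := MSet_nonempty μ1X μ0X hmarg
  have hset : ∀ t : EuclideanSpace ℝ (Fin k),
      {r : ℝ | ∃ μ ∈ MSet μ1X μ0X, r = ∫ p, ⟪t, m p⟫ ∂μ} =
      (fun v => ⟪t, v⟫) '' ((fun μ : Measure (Y1 × Y0 × X) => ∫ p, m p ∂μ) '' MSet μ1X μ0X) := by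
    intro t
    ext r
    simp only [Set.mem_ofPred_eq, Set.mem_image, exists_exists_and_eq_and]
    refine exists_congr fun μ => and_congr_right fun hμ => ?_
    rw [integral_inner (hmInt μ hμ) t]
    exact eq_comm
  constructor
  · rintro ⟨μ, hμ, h⟩ t -
    rw [hset]
    refine csInf_le (hK.image (by fun_prop)).bddBelow ⟨0, ⟨μ, hμ, h⟩, by simp⟩
  · intro H
    by_contra hne
    have h0 : (0 : EuclideanSpace ℝ (Fin k)) ∉
        ((fun μ : Measure (Y1 × Y0 × X) => ∫ p, m p ∂μ) '' MSet μ1X μ0X) := by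
      rintro ⟨μ, hμ, h⟩
      exact hne ⟨μ, hμ, h⟩
    obtain ⟨f, u, hu, hf⟩ := geometric_hahn_banach_point_closed hC hK.isClosed h0
    rw [map_zero] at hu
    let s := (InnerProductSpace.toDual ℝ (EuclideanSpace ℝ (Fin k))).symm f
    have hs : ∀ v, ⟪s, v⟫ = f v := fun v => InnerProductSpace.toDual_symm_apply
    have hs0 : s ≠ 0 := by
      intro h
      obtain ⟨μ, hμ⟩ := hN
      have := hf _ ⟨μ, hμ, rfl⟩
      rw [← hs, h, inner_zero_left] at this
      linarith
    have hpos : 0 < ‖s‖ := norm_pos_iff.2 hs0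
    have := H (‖s‖⁻¹ • s) (by rw [norm_smul, norm_inv, norm_norm, inv_mul_cancel₀ hpos.ne'])
    rw [hset] at this
    have h2 : ‖s‖⁻¹ * u ≤ sInf ((fun v => ⟪‖s‖⁻¹ • s, v⟫) ''
        ((fun μ : Measure (Y1 × Y0 × X) => ∫ p, m p ∂μ) '' MSet μ1X μ0X)) := by
      refine le_csInf ((hN.image _).image _) ?_
      rintro _ ⟨v, hv, rfl⟩
      dsimp only
      rw [real_inner_smul_left, hs]
      exact mul_le_mul_of_nonneg_left (hf v hv).le (inv_nonneg.2 hpos.le)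
    have h3 : 0 < ‖s‖⁻¹ * u := mul_pos (inv_pos.2 hpos) hu
    linarith
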